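/- The monoid T presented by generators a, b, c, x_n, y_n (n ∈ ℤ) and relations a·b·x_n = b·x_n, a·b·y_n = b·y_{n+1}, c·b·x_n = b·x_{n+1}, c·b·y_n = b·y_n (n ∈ ℤ) is left cancellative, i.e., for all s, t, t' ∈ T, s·t = s·t' implies t = t'. -/

import Mathlib

/-- The alphabet of the monoid `T`: letters `a`, `b`, `c` and `x n`, `y n` for `n : ℤ`. -/
inductive TGen : Type
  | a : TGen
  | b : TGen
  | c : TGen
  | x : ℤ → TGen
  | y : ℤ → TGen
  deriving DecidableEq

/-- The defining relations of `T`: `a·b·x n = b·x n`, `a·b·y n = b·y (n+1)`,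
`c·b·x n = b·x (n+1)` and `c·b·y n = b·y n` for `n ∈ ℤ`. -/
inductive TRel : FreeMonoid TGen → FreeMonoid TGen → Prop
  | axr (n : ℤ) : TRel (.of .a * .of .b * .of (.x n)) (.of .b * .of (.x n))
  | ayr (n : ℤ) : TRel (.of .a * .of .b * .of (.y n)) (.of .b * .of (.y (n + 1)))
  | cxr (n : ℤ) : TRel (.of .c * .of .b * .of (.x n)) (.of .b * .of (.x (n + 1)))
  | cyr (n : ℤ) : TRel (.of .c * .of .b * .of (.y n)) (.of .b * .of (.y n))

/-- The monoid `T` presented by the generators `TGen` and the relations `TRel`. -/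
abbrev T : Type := PresentedMonoid TRel

/-- The images of the generators in `T`. -/
def gen (g : TGen) : T := PresentedMonoid.of TRel g

/-- The principal right ideal `sM` of a monoid. -/
def rIdeal {M : Type*} [Monoid M] (s : M) : Set M := {m | ∃ u, m = s * u}

/-- Left multiplication of a word by a letter, followed by the rewriting step given by the
defining relations (oriented from left to right) if one applies. -/
def letterAct : TGen → List TGen → List TGen
  | .a, .b :: .x n :: l => .b :: .x n :: l
  | .a, .b :: .y n :: l => .b :: .y (n + 1) :: l
  | .c, .b :: .x n :: l => .b :: .x (n + 1) :: l
  | .c, .b :: .y n :: l => .b :: .y n :: l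
  | g, l => g :: l

theorem letterAct_injective (g : TGen) : Function.Injective (letterAct g) := by
  intro l l' h
  unfold letterAct at h
  split at h <;> split at h <;> simp_all

/-- The action of the free monoid on words that extends `letterAct`. -/
def freeAct : FreeMonoid TGen →* Function.End (List TGen) :=
  FreeMonoid.lift (M := Function.End (List TGen)) letterAct

theorem freeAct_eq_of_rel (u v : FreeMonoid TGen) (h : TRel u v) : freeAct u = freeAct v := by
  cases h <;> rfl

/-- The action of `T` on words by left multiplication and rewriting. -/
def wordAct : T →* Function.End (List TGen) :=
  PresentedMonoid.lift (M := Function.End (List TGen)) letterAct freeAct_eq_of_rel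

theorem wordAct_gen (g : TGen) : wordAct (gen g) = letterAct g :=
  rfl

theorem T_induction {p : T → Prop} (one : p 1) (gen_mul : ∀ g t, p t → p (gen g * t)) (t : T) :
    p t := by
  induction t using PresentedMonoid.inductionOn with
  | _ w =>
    induction w using FreeMonoid.inductionOn' with
    | one => exact one
    | of_mul g w ih => exact gen_mul g _ ih

theorem wordAct_injective (t : T) : Function.Injective (wordAct t) := by
  induction t using T_induction with
  | one => rw [map_one]; exact Function.injective_id
  | gen_mul g t ih =>
    rw [map_mul, wordAct_gen]
    exact (letterAct_injective g).comp ih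

/-- The element of `T` represented by a word. -/
def wordProd (l : List TGen) : T := (l.map gen).prod

theorem wordProd_cons (g : TGen) (l : List TGen) : wordProd (g :: l) = gen g * wordProd l := by
  simp [wordProd]

theorem gen_mul_gen_mul_gen_mul {g h k h' k' : TGen}
    (r : TRel (.of g * .of h * .of k) (.of h' * .of k')) (t : T) :
    gen g * (gen h * (gen k * t)) = gen h' * (gen k' * t) := by
  have e : gen g * gen h * gen k = gen h' * gen k' := PresentedMonoid.mk_eq_mk_of_rel r
  simp only [← mul_assoc, e]

theorem wordProd_letterAct (g : TGen) (l : List TGen) :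
    wordProd (letterAct g l) = gen g * wordProd l := by
  unfold letterAct
  split <;> simp only [wordProd_cons]
  · exact (gen_mul_gen_mul_gen_mul (.axr _) _).symm
  · exact (gen_mul_gen_mul_gen_mul (.ayr _) _).symm
  · exact (gen_mul_gen_mul_gen_mul (.cxr _) _).symm
  · exact (gen_mul_gen_mul_gen_mul (.cyr _) _).symm

theorem wordProd_wordAct_nil (t : T) : wordProd (wordAct t []) = t := by
  induction t using T_induction with
  | one => rw [map_one]; rfl
  | gen_mul g t ih =>
    rw [map_mul, wordAct_gen]
    exact (wordProd_letterAct g _).trans (by rw [ih])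

/-- The monoid `T` is left cancellative. -/
theorem T_leftCancellative : ∀ s t t' : T, s * t = s * t' → t = t' := by
  intro s t t' h
  have e : wordAct s (wordAct t []) = wordAct s (wordAct t' []) := by
    change (wordAct s * wordAct t) [] = (wordAct s * wordAct t') []
    rw [← map_mul, ← map_mul, h]
  rw [← wordProd_wordAct_nil t, wordAct_injective s e, wordProd_wordAct_nil]
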